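/- Let n ≥ 1, let V_k and V_v be real symmetric positive semidefinite n×n matrices, let c_k, c_v ∈ ℝⁿ and α_k, α_v > 0, and suppose there exist w_k, w_v ∈ ℝⁿ with V_k w_k = c_k and V_v w_v = c_v. Define T₁ = (1/(8α_k))(c_k · w_k) + (1/(8α_v))(c_v · w_v). Then the real symmetric (2+2n)×(2+2n) block matrix whose leading 2×2 block is [[2T₁, −2T₁], [−2T₁, 2T₁]], whose first two rows continue with the row vectors [−(1/2)c_kᵀ, (1/2)c_vᵀ] and [(1/2)c_kᵀ, −(1/2)c_vᵀ], whose first two columns continue with the column vectors [−(1/2)c_k; (1/2)c_v] and [(1/2)c_k; −(1/2)c_v], and whose trailing 2n×2n block is diag(α_k V_k, α_v V_v), is positive semidefinite. -/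

import Mathlib

open Matrix

/-- Completing the square for a positive semidefinite form: the left side equals
`α yᵀ V y` with `y = u - (d / (2 α)) w`. -/
theorem Matrix.PosSemidef.complete_square_nonneg {ι : Type*} [Fintype ι]
    {V : Matrix ι ι ℝ} (hV : V.PosSemidef) {α : ℝ} (hα : 0 < α) (w u : ι → ℝ) (d : ℝ) :
    0 ≤ d ^ 2 / (4 * α) * ((V *ᵥ w) ⬝ᵥ w) - d * ((V *ᵥ w) ⬝ᵥ u) + α * (u ⬝ᵥ (V *ᵥ u)) := by
  have hsymm : w ⬝ᵥ (V *ᵥ u) = (V *ᵥ w) ⬝ᵥ u := by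
    have hT : Vᵀ = V := by simpa only [conjTranspose_eq_transpose_of_trivial] using hV.1.eq
    rw [dotProduct_mulVec, ← mulVec_transpose, hT]
  have h := mul_nonneg hα.le (hV.dotProduct_mulVec_nonneg (u - (d / (2 * α)) • w))
  simp only [star_trivial, mulVec_sub, mulVec_smul, dotProduct_sub, sub_dotProduct,
    dotProduct_smul, smul_dotProduct, smul_eq_mul, hsymm] at h
  rw [dotProduct_comm u (V *ᵥ w), dotProduct_comm w (V *ᵥ w)] at h
  refine h.trans_eq ?_
  field_simp
  ring

/-- Stability of the Carpenter–Nordström–Gottlieb (CNG) SAT coefficients: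
with `T₁ = (1/(8α_k))(c_k·w_k) + (1/(8α_v))(c_v·w_v)` the interface-penalty
matrix is positive semidefinite. -/
theorem stmt6 (n : ℕ) (hn : 1 ≤ n)
    (Vk Vv : Matrix (Fin n) (Fin n) ℝ)
    (hVk : Vk.PosSemidef) (hVv : Vv.PosSemidef)
    (ck cv : Fin n → ℝ) (αk αv : ℝ) (hαk : 0 < αk) (hαv : 0 < αv)
    (wk wv : Fin n → ℝ) (hwk : Vk *ᵥ wk = ck) (hwv : Vv *ᵥ wv = cv)
    (T1 : ℝ) (hT1 : T1 = (1 / (8 * αk)) * (ck ⬝ᵥ wk) + (1 / (8 * αv)) * (cv ⬝ᵥ wv)) :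
    (Matrix.fromBlocks
      (!![2 * T1, -(2 * T1); -(2 * T1), 2 * T1])
      (Matrix.of fun (i : Fin 2) (j : Fin n ⊕ Fin n) => Sum.elim
        (fun a => (if i = 0 then -(1 / 2 : ℝ) else (1 / 2 : ℝ)) * ck a)
        (fun b => (if i = 0 then (1 / 2 : ℝ) else -(1 / 2 : ℝ)) * cv b) j)
      (Matrix.of fun (i : Fin n ⊕ Fin n) (j : Fin 2) => Sum.elim
        (fun a => (if j = 0 then -(1 / 2 : ℝ) else (1 / 2 : ℝ)) * ck a)
        (fun b => (if j = 0 then (1 / 2 : ℝ) else -(1 / 2 : ℝ)) * cv b) i)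
      (Matrix.fromBlocks (αk • Vk) 0 0 (αv • Vv))).PosSemidef := by
  refine .of_dotProduct_mulVec_nonneg ?_ fun x => ?_
  · refine IsHermitian.fromBlocks ?_ ?_ (IsHermitian.fromBlocks ?_ ?_ ?_)
    · ext i j
      fin_cases i <;> fin_cases j <;> simp
    · ext i j
      rcases i with i | i <;> simp
    · exact hVk.1.smul (IsSelfAdjoint.all αk)
    · simp
    · exact hVv.1.smul (IsSelfAdjoint.all αv)
  · obtain ⟨p, y, rfl⟩ : ∃ p y, x = Sum.elim p y := ⟨_, _, (Sum.elim_comp_inl_inr x).symm⟩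
    obtain ⟨u, v, rfl⟩ : ∃ u v, y = Sum.elim u v := ⟨_, _, (Sum.elim_comp_inl_inr y).symm⟩
    have hk := hVk.complete_square_nonneg hαk wk u (p 0 - p 1)
    have hv := hVv.complete_square_nonneg hαv wv v (-(p 0 - p 1))
    rw [hwk] at hk
    rw [hwv] at hv
    refine (add_nonneg hk hv).trans_eq ?_
    have hB (i : Fin 2) : ((Matrix.of fun (i : Fin 2) (j : Fin n ⊕ Fin n) => Sum.elim
        (fun a => (if i = 0 then -(1 / 2 : ℝ) else (1 / 2 : ℝ)) * ck a)
        (fun b => (if i = 0 then (1 / 2 : ℝ) else -(1 / 2 : ℝ)) * cv b) j) *ᵥ Sum.elim u v) i =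
        (if i = 0 then -(1 / 2 : ℝ) else (1 / 2 : ℝ)) * (ck ⬝ᵥ u) +
          (if i = 0 then (1 / 2 : ℝ) else -(1 / 2 : ℝ)) * (cv ⬝ᵥ v) := by
      simp only [mulVec, dotProduct, of_apply, Fintype.sum_sum_type, Sum.elim_inl, Sum.elim_inr,
        Finset.mul_sum, mul_assoc]
    have hC : (Matrix.of fun (i : Fin n ⊕ Fin n) (j : Fin 2) => Sum.elim
        (fun a => (if j = 0 then -(1 / 2 : ℝ) else (1 / 2 : ℝ)) * ck a)
        (fun b => (if j = 0 then (1 / 2 : ℝ) else -(1 / 2 : ℝ)) * cv b) i) *ᵥ p =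
        Sum.elim ((-(p 0 - p 1) / 2) • ck) (((p 0 - p 1) / 2) • cv) := by
      ext (i | i) <;> simp [mulVec, dotProduct, Fin.sum_univ_two] <;> ring
    simp only [star_trivial, fromBlocks_mulVec, Sum.elim_comp_inl, Sum.elim_comp_inr, hC,
      sumElim_dotProduct_sumElim, zero_mulVec, add_zero, zero_add, smul_mulVec, dotProduct_add,
      dotProduct_smul, smul_eq_mul]
    rw [dotProduct_comm u ck, dotProduct_comm v cv]
    have hdot (q r : Fin 2 → ℝ) : q ⬝ᵥ r = q 0 * r 0 + q 1 * r 1 := by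
      simp [dotProduct, Fin.sum_univ_two]
    have hA (i : Fin 2) : (!![2 * T1, -(2 * T1); -(2 * T1), 2 * T1] *ᵥ p) i =
        if i = 0 then 2 * T1 * (p 0 - p 1) else -(2 * T1 * (p 0 - p 1)) := by
      fin_cases i <;> simp [mulVec, hdot] <;> ring
    simp only [hdot, hA, hB, if_true, one_ne_zero, if_false]
    rw [hT1]
    field_simp
    ring
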